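/- Let N be a nonnegative progressively measurable process. Then N is a Q-local martingale on [0,S) if and only if the process N/X (i.e., t ↦ N_t·(1/X_t), defined to be 0 on {X_t ∈ {0,∞}}) is a Q̂-local martingale on [0,R). -/

import Mathlib

open MeasureTheory Filter Set Topology
open scoped ENNReal NNReal

noncomputable section

namespace Paper

/-- `τ` is a stopping time with respect to the raw filtration `F`,
taking values in `[0,T] ∪ {T+1}`. -/
def IsStopT {Ω : Type*} (F : ℝ → MeasurableSpace Ω) (T : ℝ) (τ : Ω → ℝ) : Prop :=
  (∀ t : ℝ, MeasurableSet[F t] {ω | τ ω ≤ t}) ∧ ∀ ω, τ ω ∈ Icc (0:ℝ) T ∪ {T + 1}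

/-- `A ∈ F_τ`, the σ-algebra associated with the stopping time `τ`. -/
def MemFtau {Ω : Type*} (F : ℝ → MeasurableSpace Ω) (τ : Ω → ℝ) (A : Set Ω) : Prop :=
  ∀ t : ℝ, MeasurableSet[F t] (A ∩ {ω | τ ω ≤ t})

/-- the σ-algebra `F_τ` of a stopping time `τ` (for a stopping time the generating
family below is already a σ-algebra, so this is exactly the usual `F_τ`). -/
def sigmaAt {Ω : Type*} (F : ℝ → MeasurableSpace Ω) (τ : Ω → ℝ) : MeasurableSpace Ω :=
  MeasurableSpace.generateFrom {A | MemFtau F τ A}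

/-- the stopped process `N^τ`, i.e. `N^τ_t := N_{t ∧ τ ∧ T}`. -/
def stopped {Ω : Type*} (T : ℝ) (N : ℝ → Ω → ℝ≥0∞) (τ : Ω → ℝ) : ℝ → Ω → ℝ≥0∞ :=
  fun t ω => N (min t (min (τ ω) T)) ω

/-- the value of a process at a stopping time, `N_τ := N_{τ ∧ T}`. -/
def valueAt {Ω : Type*} (T : ℝ) (N : ℝ → Ω → ℝ≥0∞) (τ : Ω → ℝ) : Ω → ℝ≥0∞ :=
  fun ω => N (min (τ ω) T) ω

/-- `N` is a `P`-martingale on the time horizon `[0,T]`: it is adapted, `P`-integrable, and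
satisfies `E^P[N_t ∣ F_s] = N_s` for all `0 ≤ s ≤ t ≤ T`.  For nonnegative
(`ℝ≥0∞`-valued) integrable adapted processes the conditional-expectation identity is
equivalent to the defining set-integral identity used here. -/
def IsMart {Ω : Type*} (F : ℝ → MeasurableSpace Ω) (T : ℝ) (P : @Measure Ω (F T))
    (N : ℝ → Ω → ℝ≥0∞) : Prop :=
  (∀ t ∈ Icc (0:ℝ) T, Measurable[F t] (N t)) ∧
  (∀ t ∈ Icc (0:ℝ) T, ∫⁻ ω, N t ω ∂P ≠ ⊤) ∧
  ∀ s t : ℝ, 0 ≤ s → s ≤ t → t ≤ T → ∀ A : Set Ω, MeasurableSet[F s] A →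
    ∫⁻ ω in A, N t ω ∂P = ∫⁻ ω in A, N s ω ∂P

/-- `N` is a `P`-local martingale on `[0,T]`. -/
def IsLocMart {Ω : Type*} (F : ℝ → MeasurableSpace Ω) (T : ℝ) (P : @Measure Ω (F T))
    (N : ℝ → Ω → ℝ≥0∞) : Prop :=
  ∃ τ : ℕ → Ω → ℝ, (∀ n, IsStopT F T (τ n)) ∧ (∀ n ω, τ n ω ≤ τ (n + 1) ω) ∧
    P {ω | ∀ᶠ n in atTop, τ n ω = T + 1} = 1 ∧
    ∀ n, IsMart F T P (stopped T N (τ n))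

/-- `N` is a `P`-local martingale on the stochastic interval `[0,τ)`. -/
def IsLocMartBefore {Ω : Type*} (F : ℝ → MeasurableSpace Ω) (T : ℝ) (P : @Measure Ω (F T))
    (N : ℝ → Ω → ℝ≥0∞) (τ : Ω → ℝ) : Prop :=
  ∀ σ : Ω → ℝ, IsStopT F T σ → (∀ᵐ ω ∂P, σ ω < τ ω) → IsLocMart F T P (stopped T N σ)

/-- `N` is a `P`-martingale on the stochastic interval `[0,τ)`. -/
def IsMartBefore {Ω : Type*} (F : ℝ → MeasurableSpace Ω) (T : ℝ) (P : @Measure Ω (F T))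
    (N : ℝ → Ω → ℝ≥0∞) (τ : Ω → ℝ) : Prop :=
  ∀ σ : Ω → ℝ, IsStopT F T σ → (∀ᵐ ω ∂P, σ ω < τ ω) → IsMart F T P (stopped T N σ)

/-- the first time in `[0,T]` at which `X` is `≥ c`; equal to `T+1` if this never
happens (`inf ∅ := T+1`). -/
def hitAbove {Ω : Type*} (T : ℝ) (X : ℝ → Ω → ℝ≥0∞) (c : ℝ≥0∞) (ω : Ω) : ℝ :=
  sInf ({t ∈ Icc (0:ℝ) T | c ≤ X t ω} ∪ {T + 1})

/-- the first time in `[0,T]` at which `X` is `≤ c`; equal to `T+1` if this never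
happens (`inf ∅ := T+1`). -/
def hitBelow {Ω : Type*} (T : ℝ) (X : ℝ → Ω → ℝ≥0∞) (c : ℝ≥0∞) (ω : Ω) : ℝ :=
  sInf ({t ∈ Icc (0:ℝ) T | X t ω ≤ c} ∪ {T + 1})

/-- `R = lim_i R_i` where `R_i = inf {t ∈ [0,T] : X_t ≥ i}` (explosion time of `X`);
the nondecreasing limit is the supremum. -/
def Rt {Ω : Type*} (T : ℝ) (X : ℝ → Ω → ℝ≥0∞) (ω : Ω) : ℝ :=
  ⨆ i : ℕ, hitAbove T X (i : ℝ≥0∞) ω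

/-- `S = lim_i S_i` where `S_i = inf {t ∈ [0,T] : X_t ≤ 1/i}` (hitting time of `0`);
the nondecreasing limit is the supremum. -/
def St {Ω : Type*} (T : ℝ) (X : ℝ → Ω → ℝ≥0∞) (ω : Ω) : ℝ :=
  ⨆ i : ℕ, hitBelow T X ((i : ℝ≥0∞))⁻¹ ω

/-- The standing assumptions: `0 < T`; `(F_t)` is a (monotone) filtration that is
right-continuous on `[0,T)`; `X` is adapted with continuous `[0,∞]`-valued paths absorbed
at `0` and `∞`; `x₀ ∈ (0,∞)`; `Q` is a probability measure on `F_T` with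
`Q(R = T+1) = 1`, `Q(X_0 = x₀) = 1` and `X` a `Q`-local martingale. -/
structure Setup {Ω : Type*} (F : ℝ → MeasurableSpace Ω) (T : ℝ) (X : ℝ → Ω → ℝ≥0∞)
    (x₀ : ℝ≥0∞) (Q : @Measure Ω (F T)) : Prop where
  T_pos : 0 < T
  mono : ∀ s t : ℝ, s ≤ t → F s ≤ F t
  rightCont : ∀ t ∈ Ico (0:ℝ) T, F t = ⨅ s ∈ Ioc t T, F s
  prob : IsProbabilityMeasure Q
  adapted : ∀ t ∈ Icc (0:ℝ) T, Measurable[F t] (X t)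
  contPaths : ∀ ω, ContinuousOn (fun t => X t ω) (Icc 0 T)
  absorbing : ∀ ω, ∀ t ∈ Icc (0:ℝ) T, (X t ω = 0 ∨ X t ω = ⊤) →
    ∀ s ∈ Icc t T, X s ω = X t ω
  x₀_pos : 0 < x₀
  x₀_lt_top : x₀ < ⊤
  noExplosion : Q {ω | Rt T X ω = T + 1} = 1
  init : Q {ω | X 0 ω = x₀} = 1
  locMart : IsLocMart F T Q X

/-- The numéraire relation between `Q` and `Q̂`: for every stopping time `τ` with values
in `[0,T] ∪ {T+1}` and every `A ∈ F_τ`,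
`Q̂(A ∩ {X_τ < ∞}) = (1/x₀)·E^Q[1_A · X_τ]` (with `X_τ := X_{τ ∧ T}`). -/
def NumeraireRel {Ω : Type*} (F : ℝ → MeasurableSpace Ω) (T : ℝ) (X : ℝ → Ω → ℝ≥0∞)
    (x₀ : ℝ≥0∞) (Q Qh : @Measure Ω (F T)) : Prop :=
  ∀ τ : Ω → ℝ, IsStopT F T τ → ∀ A : Set Ω, MemFtau F τ A →
    Qh (A ∩ {ω | valueAt T X τ ω < ⊤}) = (∫⁻ ω in A, valueAt T X τ ω ∂Q) / x₀

/-- progressive measurability of `N` with respect to the raw filtration `F` on `[0,T]`: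
for every `t ∈ [0,T]`, the map `(s,ω) ↦ N_s(ω)` on `[0,t] × Ω` is
`B([0,t]) ⊗ F_t`-measurable. -/
def ProgMeas {Ω : Type*} (F : ℝ → MeasurableSpace Ω) (T : ℝ)
    (N : ℝ → Ω → ℝ≥0∞) : Prop :=
  ∀ t ∈ Icc (0:ℝ) T,
    @Measurable (Icc (0:ℝ) t × Ω) ℝ≥0∞ (@Prod.instMeasurableSpace _ _ _ (F t)) _
      (fun p => N p.1 p.2)

section StoppingTimes

variable {Ω : Type*} {F : ℝ → MeasurableSpace Ω} {T : ℝ}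

theorem IsStopT.nonneg (hT : 0 < T) {τ : Ω → ℝ} (h : IsStopT F T τ) (ω : Ω) : 0 ≤ τ ω := by
  rcases h.2 ω with h | h
  · exact h.1
  · rw [mem_singleton_iff] at h
    linarith

/-- A random time with the right range is a stopping time as soon as the measurability condition
holds for times in `[0,T]`. -/
theorem IsStopT.of_Icc (hT : 0 < T) (hmono : ∀ s t : ℝ, s ≤ t → F s ≤ F t) {τ : Ω → ℝ}
    (hmem : ∀ ω, τ ω ∈ Icc (0:ℝ) T ∪ {T + 1})
    (h : ∀ t ∈ Icc (0:ℝ) T, MeasurableSet[F t] {ω | τ ω ≤ t}) : IsStopT F T τ := by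
  refine ⟨fun t => ?_, hmem⟩
  rcases lt_or_ge t 0 with ht | ht
  · have : {ω | τ ω ≤ t} = ∅ := by
      ext ω
      simp only [mem_ofPred_eq, mem_empty_iff_false, iff_false, not_le]
      rcases hmem ω with h | h
      · exact ht.trans_le h.1
      · rw [mem_singleton_iff] at h
        linarith
    rw [this]
    exact @MeasurableSet.empty _ (F t)
  rcases le_or_gt t T with htT | htT
  · exact h t ⟨ht, htT⟩
  rcases lt_or_ge t (T + 1) with ht1 | ht1
  · have : {ω | τ ω ≤ t} = {ω | τ ω ≤ T} := by
      ext ω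
      simp only [mem_ofPred_eq]
      refine ⟨fun hω => ?_, fun hω => hω.trans htT.le⟩
      rcases hmem ω with h | h
      · exact h.2
      · rw [mem_singleton_iff] at h
        linarith
    rw [this]
    exact hmono T t htT.le _ (h T ⟨hT.le, le_rfl⟩)
  · have : {ω | τ ω ≤ t} = univ := by
      ext ω
      simp only [mem_ofPred_eq, mem_univ, iff_true]
      rcases hmem ω with h | h
      · linarith [h.2]
      · rw [mem_singleton_iff] at h
        linarith
    rw [this]
    exact MeasurableSet.univ

theorem IsStopT.const {s : ℝ} (hs : s ∈ Icc (0:ℝ) T) : IsStopT F T (fun _ => s) :=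
  ⟨fun _ => MeasurableSet.const _, fun _ => Or.inl hs⟩

theorem IsStopT.min {σ τ : Ω → ℝ} (hσ : IsStopT F T σ) (hτ : IsStopT F T τ) :
    IsStopT F T (fun ω => min (σ ω) (τ ω)) := by
  refine ⟨fun t => ?_, fun ω => ?_⟩
  · have : {ω | Min.min (σ ω) (τ ω) ≤ t} = {ω | σ ω ≤ t} ∪ {ω | τ ω ≤ t} := by
      ext ω
      simp
    rw [this]
    exact (hσ.1 t).union (hτ.1 t)
  · show Min.min (σ ω) (τ ω) ∈ _
    rcases min_choice (σ ω) (τ ω) with h | h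
    · rw [h]
      exact hσ.2 ω
    · rw [h]
      exact hτ.2 ω

theorem IsStopT.measurable_min (hmono : ∀ s t : ℝ, s ≤ t → F s ≤ F t) {τ : Ω → ℝ}
    (h : IsStopT F T τ) (t : ℝ) : Measurable[F t] (fun ω => Min.min (τ ω) t) := by
  let _ : MeasurableSpace Ω := F t
  refine measurable_of_Iic fun u => ?_
  rcases le_or_gt t u with htu | htu
  · have : (fun ω => Min.min (τ ω) t) ⁻¹' Iic u = univ := by
      ext ω
      simp [htu]
    rw [this]
    exact MeasurableSet.univ
  · have : (fun ω => Min.min (τ ω) t) ⁻¹' Iic u = {ω | τ ω ≤ u} := by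
      ext ω
      simp [htu]
    rw [this]
    exact hmono u t htu.le _ (h.1 u)

/-- `{σ < τ} ∈ F_σ`. -/
theorem IsStopT.memFtau_lt_left (hmono : ∀ s t : ℝ, s ≤ t → F s ≤ F t) {σ τ : Ω → ℝ}
    (hσ : IsStopT F T σ) (hτ : IsStopT F T τ) : MemFtau F σ {ω | σ ω < τ ω} := by
  intro t
  have : {ω | σ ω < τ ω} ∩ {ω | σ ω ≤ t} =
      ({ω | τ ω ≤ t}ᶜ ∪ {ω | Min.min (σ ω) t < Min.min (τ ω) t}) ∩ {ω | σ ω ≤ t} := by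
    ext ω
    simp only [mem_inter_iff, mem_ofPred_eq, mem_union, mem_compl_iff, not_le]
    refine and_congr_left fun hst => ?_
    rcases lt_or_ge t (τ ω) with h | h
    · simp [h, hst.trans_lt h]
    · simp [h, hst, not_lt.2 h]
  rw [this]
  refine MeasurableSet.inter (MeasurableSet.union (hτ.1 t).compl ?_) (hσ.1 t)
  let _ : MeasurableSpace Ω := F t
  exact measurableSet_lt (hσ.measurable_min hmono t)
    (hτ.measurable_min hmono t)

/-- `{σ < τ} ∈ F_τ`. -/
theorem IsStopT.memFtau_lt_right (hmono : ∀ s t : ℝ, s ≤ t → F s ≤ F t) {σ τ : Ω → ℝ}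
    (hσ : IsStopT F T σ) (hτ : IsStopT F T τ) : MemFtau F τ {ω | σ ω < τ ω} := by
  intro t
  have : {ω | σ ω < τ ω} ∩ {ω | τ ω ≤ t} =
      {ω | Min.min (σ ω) t < Min.min (τ ω) t} ∩ {ω | τ ω ≤ t} := by
    ext ω
    simp only [mem_inter_iff, mem_ofPred_eq]
    refine and_congr_left fun hst => ?_
    rw [min_eq_left hst]
    rcases lt_or_ge t (σ ω) with h | h
    · simp [h.le, not_lt.2 (hst.trans h.le), hst]
    · simp [h]
  rw [this]
  refine MeasurableSet.inter ?_ (hτ.1 t)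
  let _ : MeasurableSpace Ω := F t
  exact measurableSet_lt (hσ.measurable_min hmono t)
    (hτ.measurable_min hmono t)

theorem MemFtau.compl {τ : Ω → ℝ} (hτ : IsStopT F T τ) {A : Set Ω} (hA : MemFtau F τ A) :
    MemFtau F τ Aᶜ := by
  intro t
  have : Aᶜ ∩ {ω | τ ω ≤ t} = {ω | τ ω ≤ t} \ (A ∩ {ω | τ ω ≤ t}) := by
    ext ω
    simp only [mem_inter_iff, mem_compl_iff, mem_ofPred_eq, Set.mem_sdiff]
    tauto
  rw [this]
  exact (hτ.1 t).diff (hA t)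

theorem MemFtau.iUnion {τ : Ω → ℝ} {A : ℕ → Set Ω} (hA : ∀ n, MemFtau F τ (A n)) :
    MemFtau F τ (⋃ n, A n) := by
  intro t
  rw [iUnion_inter]
  exact MeasurableSet.iUnion fun n => hA n t

theorem MemFtau.measurableSet {τ : Ω → ℝ} (hτT : ∀ ω, τ ω ≤ T) {A : Set Ω}
    (hA : MemFtau F τ A) : MeasurableSet[F T] A := by
  have := hA T
  rwa [show A ∩ {ω | τ ω ≤ T} = A by simp [hτT]] at this

/-- The σ-algebra `F_τ` of a stopping time `τ`. -/
@[reducible]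
def stopSigma {τ : Ω → ℝ} (hτ : IsStopT F T τ) : MeasurableSpace Ω where
  MeasurableSet' := MemFtau F τ
  measurableSet_empty t := by
    rw [empty_inter]
    exact @MeasurableSet.empty _ (F t)
  measurableSet_compl _ hA := hA.compl hτ
  measurableSet_iUnion _ hA := MemFtau.iUnion hA

theorem stopSigma_le {τ : Ω → ℝ} (hτ : IsStopT F T τ) (hτT : ∀ ω, τ ω ≤ T) :
    stopSigma hτ ≤ F T :=
  fun _ hA => MemFtau.measurableSet hτT hA

/-- The time equal to `σ ∧ τ` (that is `σ`) on `{σ < ρ}` and to `τ` elsewhere, for `ρ ≤ τ`. -/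
theorem IsStopT.ite_lt (hmono : ∀ s t : ℝ, s ≤ t → F s ≤ F t) {σ ρ τ : Ω → ℝ}
    (hσ : IsStopT F T σ) (hρ : IsStopT F T ρ) (hτ : IsStopT F T τ) (hρτ : ∀ ω, ρ ω ≤ τ ω) :
    IsStopT F T (fun ω => if σ ω < ρ ω then σ ω else τ ω) := by
  refine ⟨fun t => ?_, fun ω => ?_⟩
  · have : {ω | (if σ ω < ρ ω then σ ω else τ ω) ≤ t} =
        ({ω | σ ω < ρ ω} ∩ {ω | σ ω ≤ t}) ∪
          (({ω | σ ω < ρ ω}ᶜ ∩ {ω | ρ ω ≤ t}) ∩ {ω | τ ω ≤ t}) := by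
      ext ω
      have := hρτ ω
      by_cases h : σ ω < ρ ω
      · simp [h]
      · simp only [h, ↓reduceIte, mem_ofPred_eq, mem_union, mem_inter_iff, false_and,
          mem_compl_iff, not_false_eq_true, true_and, false_or]
        exact ⟨fun h => ⟨this.trans h, h⟩, fun h => h.2⟩
    rw [this]
    exact (hσ.memFtau_lt_left hmono hρ t).union
      ((((hσ.memFtau_lt_right hmono hρ).compl hρ) t).inter (hτ.1 t))
  · dsimp only
    split_ifs
    exacts [hσ.2 ω, hτ.2 ω]

/-- The time equal to `s ∧ τ` on `A ∈ F_s` and to `t ∧ τ` elsewhere. -/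
theorem IsStopT.piecewise (hmono : ∀ s t : ℝ, s ≤ t → F s ≤ F t) {τ : Ω → ℝ}
    (hτ : IsStopT F T τ) {s t : ℝ} (hs : 0 ≤ s) (hst : s ≤ t) (htT : t ≤ T) {A : Set Ω}
    (hA : MeasurableSet[F s] A) [DecidablePred (· ∈ A)] :
    IsStopT F T (fun ω => if ω ∈ A then Min.min s (τ ω) else Min.min t (τ ω)) := by
  have h1 := (IsStopT.const (F := F) ⟨hs, hst.trans htT⟩).min hτ
  have h2 := (IsStopT.const (F := F) ⟨hs.trans hst, htT⟩).min hτ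
  refine ⟨fun u => ?_, fun ω => ?_⟩
  · rcases lt_or_ge u s with hu | hu
    · have : {ω | (if ω ∈ A then Min.min s (τ ω) else Min.min t (τ ω)) ≤ u} = {ω | τ ω ≤ u} := by
        ext ω
        by_cases h : ω ∈ A <;> simp [h, hu, hu.trans_le hst]
      rw [this]
      exact hτ.1 u
    · have : {ω | (if ω ∈ A then Min.min s (τ ω) else Min.min t (τ ω)) ≤ u} =
          (A ∩ {ω | Min.min s (τ ω) ≤ u}) ∪ (Aᶜ ∩ {ω | Min.min t (τ ω) ≤ u}) := by
        ext ω
        by_cases h : ω ∈ A <;> simp [h]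
      rw [this]
      have hA' := hmono s u hu _ hA
      exact (hA'.inter (h1.1 u)).union (hA'.compl.inter (h2.1 u))
  · dsimp only
    split_ifs
    exacts [h1.2 ω, h2.2 ω]

/-- The time equal to `σ` on `{σ ≤ ρ}` and to `T + 1` elsewhere. -/
theorem IsStopT.ite_top (hT : 0 < T) (hmono : ∀ s t : ℝ, s ≤ t → F s ≤ F t) {σ ρ : Ω → ℝ}
    (hσ : IsStopT F T σ) (hρ : IsStopT F T ρ) :
    IsStopT F T (fun ω => if ρ ω < σ ω then T + 1 else σ ω) := by
  refine .of_Icc hT hmono (fun ω => ?_) fun t ht => ?_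
  · split_ifs
    exacts [Or.inr rfl, hσ.2 ω]
  · have : {ω | (if ρ ω < σ ω then T + 1 else σ ω) ≤ t} =
        {ω | ρ ω < σ ω}ᶜ ∩ {ω | σ ω ≤ t} := by
      ext ω
      by_cases h : ρ ω < σ ω
      · have := ht.2
        simp only [mem_ofPred_eq, h, ↓reduceIte, mem_inter_iff, mem_compl_iff, not_true_eq_false,
          false_and, iff_false, not_le]
        linarith
      · simp [h]
    rw [this]
    exact (hρ.memFtau_lt_right hmono hσ).compl hσ t

theorem IsStopT.iInf (hT : 0 < T) (hmono : ∀ s t : ℝ, s ≤ t → F s ≤ F t)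
    (hrc : ∀ t ∈ Ico (0:ℝ) T, F t = ⨅ s ∈ Ioc t T, F s) {τ : ℕ → Ω → ℝ}
    (hτ : ∀ n, IsStopT F T (τ n)) : IsStopT F T (fun ω => ⨅ n, τ n ω) := by
  have hbdd : ∀ ω, BddBelow (range fun n => τ n ω) := fun ω =>
    ⟨0, by rintro _ ⟨n, rfl⟩; exact (hτ n).nonneg hT ω⟩
  have hall : ∀ ω, (∀ n, τ n ω = T + 1) → ⨅ n, τ n ω = T + 1 := fun ω h => by simp [h]
  have hex : ∀ ω, (∃ n, τ n ω ≤ T) ∨ ∀ n, τ n ω = T + 1 := by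
    intro ω
    by_cases h : ∃ n, τ n ω ≤ T
    · exact Or.inl h
    · push Not at h
      refine Or.inr fun n => ?_
      rcases (hτ n).2 ω with h' | h'
      · exact absurd h'.2 (not_le.2 (h n))
      · exact h'
  refine .of_Icc hT hmono (fun ω => ?_) fun t ht => ?_
  · rcases hex ω with ⟨n, hn⟩ | h
    · exact Or.inl ⟨le_ciInf fun n => (hτ n).nonneg hT ω, (ciInf_le (hbdd ω) n).trans hn⟩
    · exact Or.inr (hall ω h)
  · rcases ht.2.eq_or_lt with rfl | htT
    · have : {ω | ⨅ n, τ n ω ≤ t} = ⋃ n, {ω | τ n ω ≤ t} := by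
        ext ω
        simp only [mem_ofPred_eq, mem_iUnion]
        refine ⟨fun h => ?_, fun ⟨n, hn⟩ => (ciInf_le (hbdd ω) n).trans hn⟩
        rcases hex ω with h' | h'
        · exact h'
        · rw [hall ω h'] at h
          linarith
      rw [this]
      exact MeasurableSet.iUnion fun n => (hτ n).1 t
    · rw [hrc t ⟨ht.1, htT⟩]
      simp only [MeasurableSpace.measurableSet_iInf]
      intro s hs
      have : {ω | ⨅ n, τ n ω ≤ t} =
          ⋂ j : ℕ, ⋃ n, {ω | τ n ω ≤ t + (s - t) / (j + 1)} := by
        ext ω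
        simp only [mem_ofPred_eq, mem_iInter, mem_iUnion]
        constructor
        · intro h j
          have : 0 < (s - t) / (j + 1) := div_pos (sub_pos.2 hs.1) (by positivity)
          obtain ⟨n, hn⟩ := exists_lt_of_ciInf_lt (lt_of_le_of_lt h (lt_add_of_pos_right t this))
          exact ⟨n, hn.le⟩
        · intro h
          have hlim : Tendsto (fun j : ℕ => t + (s - t) / ((j : ℝ) + 1)) atTop (𝓝 (t + 0)) :=
            tendsto_const_nhds.add <| by
              simpa using (tendsto_add_atTop_iff_nat 1).2
                (tendsto_const_div_atTop_nhds_zero_nat (s - t))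
          rw [add_zero] at hlim
          refine ge_of_tendsto' hlim fun j => ?_
          obtain ⟨n, hn⟩ := h j
          exact (ciInf_le (hbdd ω) n).trans hn
      rw [this]
      refine MeasurableSet.iInter fun j => MeasurableSet.iUnion fun n => ?_
      refine hmono _ s ?_ _ ((hτ n).1 _)
      have : (s - t) / ((j : ℝ) + 1) ≤ s - t :=
        div_le_self (sub_pos.2 hs.1).le (by linarith [Nat.cast_nonneg (α := ℝ) j])
      linarith

end StoppingTimes

section OptionalSampling

variable {Ω : Type*} {F : ℝ → MeasurableSpace Ω} {T : ℝ} {P : @Measure Ω (F T)}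
  {Z : ℝ → Ω → ℝ≥0∞}

/-- Optional sampling up to `τ`: the integral of `Z` at any stopping time before `τ` agrees with
the integral of `Z` at time zero. -/
def OptSampling (F : ℝ → MeasurableSpace Ω) (T : ℝ) (P : @Measure Ω (F T))
    (Z : ℝ → Ω → ℝ≥0∞) (τ : Ω → ℝ) : Prop :=
  ∀ κ : Ω → ℝ, IsStopT F T κ → (∀ ω, κ ω ≤ τ ω) →
    ∫⁻ ω, Z (κ ω) ω ∂P = ∫⁻ ω, Z 0 ω ∂P

theorem OptSampling.mono {σ τ : Ω → ℝ} (h : OptSampling F T P Z τ) (hστ : ∀ ω, σ ω ≤ τ ω) :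
    OptSampling F T P Z σ :=
  fun κ hκ hle => h κ hκ fun ω => (hle ω).trans (hστ ω)

/-- A progressively measurable process sampled at a stopping time. -/
theorem ProgMeas.measurable_min (hmono : ∀ s t : ℝ, s ≤ t → F s ≤ F t) (hT : 0 < T)
    (hZ : ProgMeas F T Z) {τ : Ω → ℝ} (hτ : IsStopT F T τ) {t : ℝ} (ht : t ∈ Icc (0:ℝ) T) :
    Measurable[F t] (fun ω => Z (min t (τ ω)) ω) := by
  let _ : MeasurableSpace Ω := F t
  have h1 : Measurable (fun ω => min t (τ ω)) := by
    simpa only [min_comm] using hτ.measurable_min hmono t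
  have h2 : Measurable (fun ω => ((⟨min t (τ ω), le_min ht.1 (hτ.nonneg hT ω), min_le_left _ _⟩ :
      Icc (0:ℝ) t), ω)) := (h1.subtype_mk).prodMk measurable_id
  exact (hZ t ht).comp h2

theorem ProgMeas.measurable_stopSigma (hmono : ∀ s t : ℝ, s ≤ t → F s ≤ F t) (hT : 0 < T)
    (hZ : ProgMeas F T Z) {τ : Ω → ℝ} (hτ : IsStopT F T τ) (hτT : ∀ ω, τ ω ≤ T) :
    Measurable[stopSigma hτ] (fun ω => Z (τ ω) ω) := by
  intro B hB t
  rcases lt_or_ge t 0 with ht | ht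
  · have : {ω | τ ω ≤ t} = ∅ := by
      ext ω
      simpa using ht.trans_le (hτ.nonneg hT ω)
    rw [this, inter_empty]
    exact @MeasurableSet.empty _ (F t)
  have h := hZ.measurable_min hmono hT hτ (t := min t T) ⟨le_min ht hT.le, min_le_right _ _⟩
  have : (fun ω => Z (τ ω) ω) ⁻¹' B ∩ {ω | τ ω ≤ t} =
      (fun ω => Z (min (min t T) (τ ω)) ω) ⁻¹' B ∩ {ω | τ ω ≤ t} := by
    ext ω
    simp only [mem_inter_iff, mem_preimage, mem_ofPred_eq]
    refine and_congr_left fun hω => ?_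
    rw [min_eq_right (le_min hω (hτT ω))]
  rw [this]
  exact (hmono _ t (min_le_left _ _) _ (h hB)).inter (hτ.1 t)

theorem OptSampling.isMart (hmono : ∀ s t : ℝ, s ≤ t → F s ≤ F t) (hT : 0 < T)
    (hZ : ProgMeas F T Z) (h0 : ∫⁻ ω, Z 0 ω ∂P ≠ ⊤) {τ : Ω → ℝ} (hτ : IsStopT F T τ)
    (h : OptSampling F T P Z τ) : IsMart F T P (fun t ω => Z (min t (τ ω)) ω) := by
  have hE : ∀ t ∈ Icc (0:ℝ) T, ∫⁻ ω, Z (min t (τ ω)) ω ∂P = ∫⁻ ω, Z 0 ω ∂P := fun t ht =>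
    h _ ((IsStopT.const ht).min hτ) fun ω => min_le_right _ _
  refine ⟨fun t ht => hZ.measurable_min hmono hT hτ ht, fun t ht => (hE t ht).trans_ne h0, ?_⟩
  intro s t hs hst htT A hA
  classical
  have hA' : MeasurableSet[F T] A := hmono s T (hst.trans htT) _ hA
  have key := h _ (hτ.piecewise hmono hs hst htT hA) fun ω => by
    split_ifs <;> exact min_le_right _ _
  rw [← hE t ⟨hs.trans hst, htT⟩, ← lintegral_add_compl _ hA',
    ← lintegral_add_compl (fun ω => Z (min t (τ ω)) ω) hA'] at key
  have e1 : ∫⁻ ω in A, Z (if ω ∈ A then min s (τ ω) else min t (τ ω)) ω ∂P =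
      ∫⁻ ω in A, Z (min s (τ ω)) ω ∂P :=
    setLIntegral_congr_fun hA' fun ω hω => by simp only [if_pos hω]
  have e2 : ∫⁻ ω in Aᶜ, Z (if ω ∈ A then min s (τ ω) else min t (τ ω)) ω ∂P =
      ∫⁻ ω in Aᶜ, Z (min t (τ ω)) ω ∂P :=
    setLIntegral_congr_fun hA'.compl fun ω hω => by simp only [if_neg hω]
  rw [e1, e2] at key
  have hfin : ∫⁻ ω in Aᶜ, Z (min t (τ ω)) ω ∂P ≠ ⊤ :=
    ((setLIntegral_le_lintegral _ _).trans_lt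
      ((hE t ⟨hs.trans hst, htT⟩).trans_lt h0.lt_top)).ne
  exact ((ENNReal.add_left_inj hfin).1 key).symm

theorem IsStopT.ae_eventually_iff (hP : IsProbabilityMeasure P) {θ : ℕ → Ω → ℝ}
    (hθ : ∀ n, IsStopT F T (θ n)) :
    (∀ᵐ ω ∂P, ∀ᶠ n in atTop, θ n ω = T + 1) ↔ P {ω | ∀ᶠ n in atTop, θ n ω = T + 1} = 1 := by
  refine mem_ae_iff_prob_eq_one (μ := P) ?_
  have : {ω | ∀ᶠ n in atTop, θ n ω = T + 1} = ⋃ m, ⋂ n, ⋂ _ : m ≤ n, {ω | θ n ω ≤ T}ᶜ := by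
    ext ω
    simp only [mem_ofPred_eq, eventually_atTop, mem_iUnion, mem_iInter, mem_compl_iff, not_le]
    refine exists_congr fun m => forall₂_congr fun n _ => ?_
    rcases (hθ n).2 ω with h | h
    · exact ⟨fun h' => by linarith [h.2], fun h' => absurd h.2 (not_le.2 h')⟩
    · rw [mem_singleton_iff] at h
      exact ⟨fun _ => by linarith, fun _ => h⟩
  rw [this]
  exact MeasurableSet.iUnion fun m => MeasurableSet.iInter fun n => MeasurableSet.iInter fun _ =>
    ((hθ n).1 T).compl

theorem IsMart.lintegral_eq {M : ℝ → Ω → ℝ≥0∞} (hT : 0 < T) (h : IsMart F T P M) :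
    ∫⁻ ω, M T ω ∂P = ∫⁻ ω, M 0 ω ∂P := by
  simpa using h.2.2 0 T le_rfl hT.le le_rfl univ (@MeasurableSet.univ _ (F 0))

/-- The expectation of a nonnegative local martingale is nonincreasing. -/
theorem IsLocMart.lintegral_le (hP : IsProbabilityMeasure P) {M : ℝ → Ω → ℝ≥0∞} (hT : 0 < T)
    (h : IsLocMart F T P M) : ∫⁻ ω, M T ω ∂P ≤ ∫⁻ ω, M 0 ω ∂P := by
  obtain ⟨θ, hθ, -, hev, hmart⟩ := h
  have hev' : ∀ᵐ ω ∂P, ∀ᶠ n in atTop, θ n ω = T + 1 := by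
    rwa [IsStopT.ae_eventually_iff hP hθ]
  have hE : ∀ n, ∫⁻ ω, stopped T M (θ n) T ω ∂P = ∫⁻ ω, M 0 ω ∂P := fun n => by
    rw [(hmart n).lintegral_eq hT]
    refine lintegral_congr fun ω => ?_
    simp only [stopped]
    rw [min_eq_left (le_min ((hθ n).nonneg hT ω) hT.le)]
  calc ∫⁻ ω, M T ω ∂P = ∫⁻ ω, liminf (fun n => stopped T M (θ n) T ω) atTop ∂P := by
        refine lintegral_congr_ae (hev'.mono fun ω hω => ?_)
        refine (Tendsto.liminf_eq ?_).symm
        refine tendsto_const_nhds.congr' (hω.mono fun n hn => ?_)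
        simp [stopped, hn]
    _ ≤ liminf (fun n => ∫⁻ ω, stopped T M (θ n) T ω ∂P) atTop :=
        lintegral_liminf_le fun n => (hmart n).1 T ⟨hT.le, le_rfl⟩
    _ = ∫⁻ ω, M 0 ω ∂P := by simp [hE]

theorem tendsto_measure_zero_of_ae_eventually_notMem (hP : IsProbabilityMeasure P)
    {A : ℕ → Set Ω} (hA : ∀ n, MeasurableSet[F T] (A n))
    (h : ∀ᵐ ω ∂P, ∀ᶠ n in atTop, ω ∉ A n) : Tendsto (fun n => P (A n)) atTop (𝓝 0) := by
  let _ : MeasurableSpace Ω := F T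
  have := tendsto_measure_of_ae_tendsto_indicator_of_isFiniteMeasure (μ := P) (A := ∅) atTop
    (@MeasurableSet.empty _ (F T)) hA (h.mono fun ω hω => hω.mono fun n hn => by simp [hn])
  simpa using this

/-- If all stoppings of `Z` before `τ` are local martingales and the expectation of `Z` at `τ` is
the initial one, then optional sampling holds up to `τ`. No path regularity is needed. -/
theorem OptSampling.of_isLocMart (hP : IsProbabilityMeasure P)
    (hmono : ∀ s t : ℝ, s ≤ t → F s ≤ F t) (hT : 0 < T) {τ : Ω → ℝ} (hτ : IsStopT F T τ)
    (hτT : ∀ ω, τ ω ≤ T)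
    (hloc : ∀ ρ, IsStopT F T ρ → (∀ ω, ρ ω ≤ τ ω) → IsLocMart F T P (stopped T Z ρ))
    (hE : ∫⁻ ω, Z (τ ω) ω ∂P = ∫⁻ ω, Z 0 ω ∂P) (h0 : ∫⁻ ω, Z 0 ω ∂P ≠ ⊤) :
    OptSampling F T P Z τ := by
  have hend : ∀ ρ : Ω → ℝ, (∀ ω, ρ ω ≤ τ ω) → ∀ ω, stopped T Z ρ T ω = Z (ρ ω) ω := by
    intro ρ hρτ ω
    have := (hρτ ω).trans (hτT ω)
    simp only [stopped, min_eq_left this, min_eq_right this]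
  have hstart : ∀ ρ : Ω → ℝ, IsStopT F T ρ → ∀ ω, stopped T Z ρ 0 ω = Z 0 ω := by
    intro ρ hρ ω
    simp only [stopped]
    rw [min_eq_left (le_min (hρ.nonneg hT ω) hT.le)]
  have hsup : ∀ ρ, IsStopT F T ρ → (∀ ω, ρ ω ≤ τ ω) →
      ∫⁻ ω, Z (ρ ω) ω ∂P ≤ ∫⁻ ω, Z 0 ω ∂P := by
    intro ρ hρ hρτ
    have := (hloc ρ hρ hρτ).lintegral_le hP hT
    simpa only [hend ρ hρτ, hstart ρ hρ] using this
  intro ρ hρ hρτ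
  refine le_antisymm (hsup ρ hρ hρτ) ?_
  obtain ⟨θ, hθ, -, hev, hmart⟩ := hloc ρ hρ hρτ
  rw [← IsStopT.ae_eventually_iff hP hθ] at hev
  have hρT : ∀ ω, ρ ω ≤ T := fun ω => (hρτ ω).trans (hτT ω)
  have hA : ∀ j, MeasurableSet[F T] {ω | θ j ω < ρ ω} := fun j =>
    ((hθ j).memFtau_lt_right hmono hρ).measurableSet hρT
  have hlim : Tendsto (fun j => P {ω | θ j ω < ρ ω}) atTop (𝓝 0) := by
    refine tendsto_measure_zero_of_ae_eventually_notMem hP hA (hev.mono fun ω hω =>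
      hω.mono fun j hj => ?_)
    simp only [mem_ofPred_eq, hj, not_lt]
    linarith [hρT ω]
  have hstep : ∀ j, ∫⁻ ω, Z 0 ω ∂P ≤
      ∫⁻ ω in {ω | θ j ω < ρ ω}, Z (τ ω) ω ∂P + ∫⁻ ω, Z (ρ ω) ω ∂P := by
    intro j
    have hκ : ∫⁻ ω, Z (min (ρ ω) (θ j ω)) ω ∂P = ∫⁻ ω, Z 0 ω ∂P := by
      have := (hmart j).lintegral_eq hT
      simp only [stopped, min_eq_left (hρT _)] at this
      rw [lintegral_congr fun ω => ?_, this, lintegral_congr fun ω => ?_]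
      · have := (hθ j).nonneg hT ω
        rw [min_eq_left (le_min this hT.le), min_eq_left (hρ.nonneg hT ω)]
      · congr 1
        have := hρT ω
        rw [min_comm (ρ ω), min_eq_right (min_le_right (θ j ω) T), min_assoc, min_eq_right this]
    have hκ' := hsup _ ((hθ j).ite_lt hmono hρ hτ hρτ) fun ω => by
      split_ifs with h
      exacts [h.le.trans (hρτ ω), le_rfl]
    rw [← hE, ← lintegral_add_compl _ (hA j),
      ← lintegral_add_compl (fun ω => Z (τ ω) ω) (hA j)] at hκ'
    have e1 : ∫⁻ ω in {ω | θ j ω < ρ ω}, Z (if θ j ω < ρ ω then θ j ω else τ ω) ω ∂P =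
        ∫⁻ ω in {ω | θ j ω < ρ ω}, Z (min (ρ ω) (θ j ω)) ω ∂P :=
      setLIntegral_congr_fun (hA j) fun ω hω => by
        have hω' : θ j ω < ρ ω := hω
        simp only [if_pos hω', min_eq_right hω'.le]
    have e2 : ∫⁻ ω in {ω | θ j ω < ρ ω}ᶜ, Z (if θ j ω < ρ ω then θ j ω else τ ω) ω ∂P =
        ∫⁻ ω in {ω | θ j ω < ρ ω}ᶜ, Z (τ ω) ω ∂P :=
      setLIntegral_congr_fun (hA j).compl fun ω hω => by
        have hω' : ¬ θ j ω < ρ ω := hω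
        simp only [if_neg hω']
    have hfin : ∫⁻ ω in {ω | θ j ω < ρ ω}ᶜ, Z (τ ω) ω ∂P ≠ ⊤ :=
      ((setLIntegral_le_lintegral _ _).trans_lt (hE.trans_lt h0.lt_top)).ne
    rw [e1, e2, ENNReal.add_le_add_iff_right hfin] at hκ'
    rw [← hκ, ← lintegral_add_compl _ (hA j)]
    refine add_le_add hκ' ?_
    calc ∫⁻ ω in {ω | θ j ω < ρ ω}ᶜ, Z (min (ρ ω) (θ j ω)) ω ∂P
        = ∫⁻ ω in {ω | θ j ω < ρ ω}ᶜ, Z (ρ ω) ω ∂P :=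
          setLIntegral_congr_fun (hA j).compl fun ω hω => by
            have hω' : ¬ θ j ω < ρ ω := hω
            simp only [min_eq_left (not_lt.1 hω')]
      _ ≤ _ := setLIntegral_le_lintegral _ _
  have hlim' : Tendsto (fun j => ∫⁻ ω in {ω | θ j ω < ρ ω}, Z (τ ω) ω ∂P +
      ∫⁻ ω, Z (ρ ω) ω ∂P) atTop (𝓝 (0 + ∫⁻ ω, Z (ρ ω) ω ∂P)) :=
    (tendsto_setLIntegral_zero (hE.trans_ne h0) hlim).add tendsto_const_nhds
  rw [zero_add] at hlim'
  exact ge_of_tendsto' hlim' hstep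

/-- If optional sampling holds up to stopping times covering `σ` with probability arbitrarily
close to one, then `Z` stopped at `σ` is a local martingale. -/
theorem IsLocMart.of_optSampling (hmono : ∀ s t : ℝ, s ≤ t → F s ≤ F t) (hT : 0 < T)
    (hrc : ∀ t ∈ Ico (0:ℝ) T, F t = ⨅ s ∈ Ioc t T, F s) (hP : IsProbabilityMeasure P)
    (hZ : ProgMeas F T Z) (h0 : ∫⁻ ω, Z 0 ω ∂P ≠ ⊤) {σ : Ω → ℝ} (hσ : IsStopT F T σ)
    (hσT : ∀ ω, σ ω ≤ T)
    (h : ∀ ε : ℝ≥0∞, 0 < ε → ∃ β, IsStopT F T β ∧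
      OptSampling F T P Z (fun ω => min (σ ω) (β ω)) ∧ P {ω | β ω ≤ σ ω} ≤ ε) :
    IsLocMart F T P (stopped T Z σ) := by
  have hpos : ∀ n : ℕ, 0 < (2⁻¹ : ℝ≥0∞) ^ n := fun n =>
    (ENNReal.pow_ne_zero (by simp) n).bot_lt
  choose β hβ hopt hmeas using fun n : ℕ => h _ (hpos n)
  let β' : ℕ → Ω → ℝ := fun n ω => if σ ω < β n ω then T + 1 else β n ω
  have hβ' : ∀ n, IsStopT F T (β' n) := fun n => (hβ n).ite_top hT hmono hσ
  have hle : ∀ n ω, β' n ω ≤ T + 1 := by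
    intro n ω
    rcases (hβ' n).2 ω with h | h
    · linarith [h.2]
    · exact h.le
  have hbdd : ∀ m ω, BddBelow (range fun n => β' (n + m) ω) := fun m ω =>
    ⟨0, by rintro _ ⟨n, rfl⟩; exact (hβ' (n + m)).nonneg hT ω⟩
  let ρ : ℕ → Ω → ℝ := fun m ω => ⨅ n, β' (n + m) ω
  have hρ : ∀ m, IsStopT F T (ρ m) := fun m =>
    IsStopT.iInf hT hmono hrc fun n => hβ' (n + m)
  refine ⟨ρ, hρ, fun m ω => le_ciInf fun n => ?_, ?_, fun m => ?_⟩
  · have := ciInf_le (hbdd m ω) (n + 1)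
    rwa [show n + 1 + m = n + (m + 1) by ring] at this
  · rw [← IsStopT.ae_eventually_iff hP hρ]
    have hsum : ∑' n, P {ω | β n ω ≤ σ ω} ≠ ⊤ := by
      refine ((ENNReal.tsum_le_tsum hmeas).trans_lt ?_).ne
      rw [ENNReal.tsum_geometric]
      simp
    filter_upwards [ae_eventually_notMem hsum] with ω hω
    obtain ⟨m, hm⟩ := eventually_atTop.1 hω
    filter_upwards [eventually_ge_atTop m] with k hk
    have : ∀ n, β' (n + k) ω = T + 1 := fun n => by
      have := hm (n + k) (hk.trans (Nat.le_add_left _ _))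
      simp only [not_le] at this
      exact if_pos this
    simp [ρ, this]
  · have hle' : ∀ ω, min (σ ω) (ρ m ω) ≤ min (σ ω) (β m ω) := by
      intro ω
      refine le_min (min_le_left _ _) ?_
      rcases lt_or_ge (σ ω) (β m ω) with h | h
      · exact (min_le_left _ _).trans h.le
      · have := ciInf_le (hbdd m ω) 0
        simp only [zero_add] at this
        rw [show β' m ω = β m ω from if_neg (not_lt.2 h)] at this
        exact (min_le_right _ _).trans this
    have := ((hopt m).mono hle').isMart hmono hT hZ h0 (hσ.min (hρ m))
    convert this using 3 with t ω
    simp only [stopped]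
    congr 1
    have := hσT ω
    grind

end OptionalSampling

section HittingTimes

variable {Ω : Type*} {F : ℝ → MeasurableSpace Ω} {T : ℝ} {Y : ℝ → Ω → ℝ≥0∞}

theorem hitBelow_mem (hc : ∀ ω, ContinuousOn (fun t => Y t ω) (Icc 0 T)) (c : ℝ≥0∞) (ω : Ω) :
    hitBelow T Y c ω ∈ {t ∈ Icc (0:ℝ) T | Y t ω ≤ c} ∪ {T + 1} := by
  have h1 : IsClosed {t ∈ Icc (0:ℝ) T | Y t ω ≤ c} :=
    (hc ω).preimage_isClosed_of_isClosed isClosed_Icc isClosed_Iic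
  have h2 : IsCompact ({t ∈ Icc (0:ℝ) T | Y t ω ≤ c} ∪ {T + 1}) :=
    (isCompact_Icc.of_isClosed_subset h1 fun t ht => ht.1).union isCompact_singleton
  exact h2.sInf_mem ⟨T + 1, Or.inr rfl⟩

theorem hitBelow_bddBelow (hT : 0 < T) (c : ℝ≥0∞) (ω : Ω) :
    BddBelow ({t ∈ Icc (0:ℝ) T | Y t ω ≤ c} ∪ {T + 1}) := by
  refine ⟨0, ?_⟩
  rintro t (ht | ht)
  · exact ht.1.1
  · rw [mem_singleton_iff] at ht
    linarith

theorem hitBelow_le (hT : 0 < T) (c : ℝ≥0∞) (ω : Ω) : hitBelow T Y c ω ≤ T + 1 :=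
  csInf_le (hitBelow_bddBelow hT c ω) (Or.inr rfl)

theorem hitBelow_le_iff (hT : 0 < T) (hc : ∀ ω, ContinuousOn (fun t => Y t ω) (Icc 0 T))
    {c : ℝ≥0∞} {ω : Ω} {t : ℝ} (ht : t ∈ Icc (0:ℝ) T) :
    hitBelow T Y c ω ≤ t ↔ ∃ s ∈ Icc (0:ℝ) t, Y s ω ≤ c := by
  constructor
  · intro h
    rcases hitBelow_mem hc c ω with h' | h'
    · exact ⟨_, ⟨h'.1.1, h⟩, h'.2⟩
    · rw [mem_singleton_iff] at h'
      linarith [ht.2]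
  · rintro ⟨s, hs, hY⟩
    exact (csInf_le (hitBelow_bddBelow hT c ω) (Or.inl ⟨⟨hs.1, hs.2.trans ht.2⟩, hY⟩)).trans hs.2

theorem hitBelow_isStopT (hT : 0 < T) (hmono : ∀ s t : ℝ, s ≤ t → F s ≤ F t)
    (hc : ∀ ω, ContinuousOn (fun t => Y t ω) (Icc 0 T))
    (had : ∀ t ∈ Icc (0:ℝ) T, Measurable[F t] (Y t)) (c : ℝ≥0∞) :
    IsStopT F T (hitBelow T Y c) := by
  refine .of_Icc hT hmono (fun ω => ?_) fun t ht => ?_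
  · exact (hitBelow_mem hc c ω).imp (fun h => h.1) id
  · have : Nonempty (Icc (0:ℝ) t) := ⟨⟨0, le_rfl, ht.1⟩⟩
    have hsub : Icc (0:ℝ) t ⊆ Icc 0 T := Icc_subset_Icc_right ht.2
    let d := TopologicalSpace.denseSeq (Icc (0:ℝ) t)
    have heq : {ω | hitBelow T Y c ω ≤ t} = {ω | ⨅ n, Y (d n) ω ≤ c} := by
      ext ω
      simp only [mem_ofPred_eq]
      rw [hitBelow_le_iff hT hc ht]
      have hcont : Continuous fun s : Icc (0:ℝ) t => Y s ω :=
        ((hc ω).mono hsub).domRestrict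
      constructor
      · rintro ⟨s, hs, hY⟩
        have hcl : IsClosed {s : Icc (0:ℝ) t | ⨅ n, Y (d n) ω ≤ Y s ω} :=
          isClosed_le continuous_const hcont
        have hd : range d ⊆ {s : Icc (0:ℝ) t | ⨅ n, Y (d n) ω ≤ Y s ω} := by
          rintro _ ⟨n, rfl⟩
          exact iInf_le (fun n => Y (d n) ω) n
        have hmem : (⟨s, hs⟩ : Icc (0:ℝ) t) ∈ closure (range d) :=
          TopologicalSpace.denseRange_denseSeq (Icc (0:ℝ) t) _
        exact le_trans (hcl.closure_subset_iff.2 hd hmem) hY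
      · intro h
        obtain ⟨s, hs, hmin⟩ := isCompact_Icc.exists_isMinOn
          (nonempty_Icc.2 ht.1) ((hc ω).mono hsub)
        exact ⟨s, hs, (le_iInf fun n => hmin (d n).2).trans h⟩
    rw [heq]
    let _ : MeasurableSpace Ω := F t
    have hm : Measurable fun ω => ⨅ n, Y (d n) ω :=
      Measurable.iInf fun n => (had _ (hsub (d n).2)).mono (hmono _ _ (d n).2.2) le_rfl
    exact hm measurableSet_Iic

theorem hitBelow_lt_of_pos (hT : 0 < T) (hc : ∀ ω, ContinuousOn (fun t => Y t ω) (Icc 0 T))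
    {ω : Ω} {s : ℝ} (hs : s ∈ Icc (0:ℝ) T) (h : ∀ u ∈ Icc (0:ℝ) s, 0 < Y u ω) :
    ∃ m : ℕ, ∀ n ≥ m, s < hitBelow T Y (n : ℝ≥0∞)⁻¹ ω := by
  obtain ⟨u, hu, hmin⟩ := isCompact_Icc.exists_isMinOn
    (nonempty_Icc.2 hs.1) ((hc ω).mono (Icc_subset_Icc_right hs.2))
  obtain ⟨m, hm⟩ := ENNReal.exists_inv_nat_lt (h u hu).ne'
  refine ⟨m, fun n hn => ?_⟩
  rw [← not_le, hitBelow_le_iff hT hc hs]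
  rintro ⟨v, hv, hY⟩
  have h1 : (n : ℝ≥0∞)⁻¹ ≤ (m : ℝ≥0∞)⁻¹ := ENNReal.inv_le_inv.2 (by exact_mod_cast hn)
  exact absurd (hm.trans_le ((hmin hv).trans hY)) (not_lt.2 h1)

theorem pos_of_absorbing
    (habs : ∀ ω, ∀ t ∈ Icc (0:ℝ) T, Y t ω = 0 → ∀ s ∈ Icc t T, Y s ω = Y t ω)
    {ω : Ω} {s : ℝ} (hs : s ∈ Icc (0:ℝ) T) (h : 0 < Y s ω) : ∀ u ∈ Icc (0:ℝ) s, 0 < Y u ω := by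
  intro u hu
  rw [pos_iff_ne_zero]
  intro h0
  have := habs ω u ⟨hu.1, hu.2.trans hs.2⟩ h0 s ⟨hu.2, hs.2⟩
  rw [this, h0] at h
  exact lt_irrefl _ h

/-- Before `T`, the time `S` has not been reached exactly when the process is positive. -/
theorem lt_St_iff (hT : 0 < T) (hc : ∀ ω, ContinuousOn (fun t => Y t ω) (Icc 0 T))
    (habs : ∀ ω, ∀ t ∈ Icc (0:ℝ) T, Y t ω = 0 → ∀ s ∈ Icc t T, Y s ω = Y t ω)
    {ω : Ω} {s : ℝ} (hs : s ∈ Icc (0:ℝ) T) : s < St T Y ω ↔ 0 < Y s ω := by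
  have hbdd : BddAbove (range fun n : ℕ => hitBelow T Y (n : ℝ≥0∞)⁻¹ ω) :=
    ⟨T + 1, by rintro _ ⟨n, rfl⟩; exact hitBelow_le hT _ ω⟩
  constructor
  · intro h
    rw [pos_iff_ne_zero]
    intro h0
    refine absurd h (not_lt.2 (ciSup_le fun n => ?_))
    rw [hitBelow_le_iff hT hc hs]
    exact ⟨s, ⟨hs.1, le_rfl⟩, h0.trans_le zero_le⟩
  · intro h
    obtain ⟨m, hm⟩ := hitBelow_lt_of_pos hT hc hs (pos_of_absorbing habs hs h)
    exact (hm m le_rfl).trans_le (le_ciSup hbdd m)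

/-- A process started away from zero is still positive when it first reaches a positive level. -/
theorem pos_at_hitBelow (hT : 0 < T) (hc : ∀ ω, ContinuousOn (fun t => Y t ω) (Icc 0 T))
    {c : ℝ≥0∞} (hc0 : 0 < c) {ω : Ω} (h0 : 0 < Y 0 ω) {s : ℝ} (hs : s ∈ Icc (0:ℝ) T)
    (hle : s ≤ hitBelow T Y c ω) : 0 < Y s ω := by
  rcases hs.1.eq_or_lt with rfl | hs0
  · exact h0
  have hlt : ∀ u ∈ Ico (0:ℝ) s, c < Y u ω := by
    intro u hu
    by_contra! hu'
    have : hitBelow T Y c ω ≤ u :=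
      (hitBelow_le_iff hT hc ⟨hu.1, hu.2.le.trans hs.2⟩).2 ⟨u, ⟨hu.1, le_rfl⟩, hu'⟩
    exact absurd (hle.trans this) (not_le.2 hu.2)
  refine hc0.trans_le ?_
  have hcont : ContinuousWithinAt (fun t => Y t ω) (Ico 0 s) s :=
    (hc ω s hs).mono fun u hu => ⟨hu.1, hu.2.le.trans hs.2⟩
  have hne : (𝓝[Ico 0 s] s).NeBot := by
    rw [← mem_closure_iff_nhdsWithin_neBot, closure_Ico hs0.ne]
    exact ⟨hs.1, le_rfl⟩
  refine ge_of_tendsto hcont ?_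
  filter_upwards [self_mem_nhdsWithin] with u hu using (hlt u hu).le

theorem Rt_eq_St_inv (X : ℝ → Ω → ℝ≥0∞) : Rt T X = St T fun t ω => (X t ω)⁻¹ := by
  ext ω
  simp only [Rt, St, hitAbove, hitBelow, ENNReal.inv_le_inv]

theorem progMeas_of_continuousOn (hmono : ∀ s t : ℝ, s ≤ t → F s ≤ F t)
    (hc : ∀ ω, ContinuousOn (fun t => Y t ω) (Icc 0 T))
    (had : ∀ t ∈ Icc (0:ℝ) T, Measurable[F t] (Y t)) : ProgMeas F T Y := by
  intro t ht
  have hsub : Icc (0:ℝ) t ⊆ Icc 0 T := Icc_subset_Icc_right ht.2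
  let _ : MeasurableSpace Ω := F t
  exact measurable_uncurry_of_continuous_of_measurable
    (u := fun (s : Icc (0:ℝ) t) ω => Y s ω) (fun ω => ((hc ω).mono hsub).domRestrict)
    fun s => (had _ (hsub s.2)).mono (hmono _ _ s.2.2) le_rfl

end HittingTimes

section Transfer

variable {Ω : Type*} {F : ℝ → MeasurableSpace Ω} {T : ℝ}

/-- Transfer of the local martingale property before the hitting time of zero by `Y` from `P`
to `P'`, given proportionality of expectations at stopping times at which both measures agree. -/
theorem IsLocMartBefore.transfer (hmono : ∀ s t : ℝ, s ≤ t → F s ≤ F t) (hT : 0 < T)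
    (hrc : ∀ t ∈ Ico (0:ℝ) T, F t = ⨅ s ∈ Ioc t T, F s) {P P' : @Measure Ω (F T)}
    (hP : IsProbabilityMeasure P) (hP' : IsProbabilityMeasure P') {Z Z' Y : ℝ → Ω → ℝ≥0∞}
    (hZ' : ProgMeas F T Z') (hc : ∀ ω, ContinuousOn (fun t => Y t ω) (Icc 0 T))
    (had : ∀ t ∈ Icc (0:ℝ) T, Measurable[F t] (Y t))
    (habs : ∀ ω, ∀ t ∈ Icc (0:ℝ) T, Y t ω = 0 → ∀ s ∈ Icc t T, Y s ω = Y t ω)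
    (hY0 : ∀ᵐ ω ∂P, 0 < Y 0 ω) (hYT : ∀ᵐ ω ∂P', 0 < Y T ω) {S' : Ω → ℝ} {c : ℝ≥0∞}
    (hctop : c ≠ ⊤)
    (hval : ∀ κ, IsStopT F T κ → (∀ ω, κ ω ≤ T) → (∀ᵐ ω ∂P', κ ω < S' ω) →
      (∀ᵐ ω ∂P, κ ω < St T Y ω) → ∫⁻ ω, Z' (κ ω) ω ∂P' = c * ∫⁻ ω, Z (κ ω) ω ∂P)
    (hnull : ∀ κ, IsStopT F T κ → (∀ ω, κ ω ≤ T) → (∀ᵐ ω ∂P', κ ω < S' ω) →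
      ∀ E, MemFtau F κ E → P E = 0 → P' E = 0)
    (h : IsLocMartBefore F T P Z (St T Y)) : IsLocMartBefore F T P' Z' S' := by
  intro σ₀ hσ₀ hσ₀S
  let σ : Ω → ℝ := fun ω => min (σ₀ ω) T
  have hσ : IsStopT F T σ := hσ₀.min (IsStopT.const ⟨hT.le, le_rfl⟩)
  have hσT : ∀ ω, σ ω ≤ T := fun ω => min_le_right _ _
  have hσS : ∀ᵐ ω ∂P', σ ω < S' ω := hσ₀S.mono fun ω hω => (min_le_left _ _).trans_lt hω
  rw [show stopped T Z' σ₀ = stopped T Z' σ by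
    ext t ω
    simp only [stopped, σ, min_assoc, min_self]]
  let H : ℕ → Ω → ℝ := fun n => hitBelow T Y (n : ℝ≥0∞)⁻¹
  have hH : ∀ n, IsStopT F T (H n) := fun n => hitBelow_isStopT hT hmono hc had _
  have hHσ : ∀ n, IsStopT F T (fun ω => min (σ ω) (H n ω)) := fun n => hσ.min (hH n)
  have hHσT : ∀ n ω, min (σ ω) (H n ω) ≤ T := fun n ω => (min_le_left _ _).trans (hσT ω)
  have hHS : ∀ n, ∀ᵐ ω ∂P, min (σ ω) (H n ω) < St T Y ω := fun n => hY0.mono fun ω hω => by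
    have hmem : min (σ ω) (H n ω) ∈ Icc (0:ℝ) T := ⟨(hHσ n).nonneg hT ω, hHσT n ω⟩
    rw [lt_St_iff hT hc habs hmem]
    exact pos_at_hitBelow hT hc (by simp) hω hmem (min_le_right _ _)
  have hloc : ∀ n ρ, IsStopT F T ρ → (∀ ω, ρ ω ≤ min (σ ω) (H n ω)) →
      IsLocMart F T P (stopped T Z ρ) := fun n ρ hρ hle =>
    h ρ hρ ((hHS n).mono fun ω hω => (hle ω).trans_lt hω)
  have hzero : IsStopT F T (fun _ : Ω => (0:ℝ)) := IsStopT.const ⟨le_rfl, hT.le⟩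
  have hmeasle : ∀ {τ : Ω → ℝ}, IsStopT F T τ → MeasurableSet[F T] {ω | τ ω ≤ σ ω} := by
    intro τ hτ
    have := ((hσ.memFtau_lt_left hmono hτ).compl hσ).measurableSet hσT
    simpa only [compl_ofPred, not_lt] using this
  -- initial values
  have hval0 : ∫⁻ ω, Z' 0 ω ∂P' = c * ∫⁻ ω, Z 0 ω ∂P :=
    hval _ hzero (fun _ => hT.le) (hσS.mono fun ω hω => (hσ.nonneg hT ω).trans_lt hω)
      ((hHS 0).mono fun ω hω => ((hHσ 0).nonneg hT ω).trans_lt hω)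
  have hstart : ∀ {ρ θ : Ω → ℝ}, IsStopT F T ρ → IsStopT F T θ → ∀ ω,
      stopped T (stopped T Z ρ) θ 0 ω = Z 0 ω := by
    intro ρ θ hρ hθ ω
    simp only [stopped]
    rw [min_eq_left (le_min (hθ.nonneg hT ω) hT.le), min_eq_left (le_min (hρ.nonneg hT ω) hT.le)]
  have hend : ∀ {ρ θ : Ω → ℝ}, (∀ ω, ρ ω ≤ T) → ∀ ω,
      stopped T (stopped T Z ρ) θ T ω = Z (min (ρ ω) (θ ω)) ω := by
    intro ρ θ hρT ω
    have := hρT ω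
    simp only [stopped]
    congr 1
    grind
  have h0 : ∫⁻ ω, Z 0 ω ∂P ≠ ⊤ := by
    obtain ⟨θ, hθ, -, -, hmart⟩ := hloc 0 _ (hHσ 0) fun ω => le_rfl
    have := (hmart 0).2.1 0 ⟨le_rfl, hT.le⟩
    simpa only [hstart (hHσ 0) (hθ 0)] using this
  have h0' : ∫⁻ ω, Z' 0 ω ∂P' ≠ ⊤ := hval0 ▸ ENNReal.mul_ne_top hctop h0
  refine IsLocMart.of_optSampling hmono hT hrc hP' hZ' h0' hσ hσT fun ε hε => ?_
  have hε2 : 0 < ε / 2 := ENNReal.half_pos hε.ne'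
  obtain ⟨n, hn⟩ : ∃ n, P' {ω | H n ω ≤ σ ω} ≤ ε / 2 := by
    have := tendsto_measure_zero_of_ae_eventually_notMem hP' (fun n => hmeasle (hH n))
      (hYT.mono fun ω hω => ?_)
    · exact (this.eventually (ge_mem_nhds hε2)).exists
    · have hTmem : T ∈ Icc (0:ℝ) T := ⟨hT.le, le_rfl⟩
      obtain ⟨m, hm⟩ := hitBelow_lt_of_pos hT hc hTmem (pos_of_absorbing habs hTmem hω)
      filter_upwards [eventually_ge_atTop m] with n hn
      exact not_le.2 ((hσT ω).trans_lt (hm n hn))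
  obtain ⟨θ, hθ, hθmono, hev, hmart⟩ := hloc n _ (hHσ n) fun ω => le_rfl
  rw [← IsStopT.ae_eventually_iff hP hθ] at hev
  -- the choice of the localising time
  obtain ⟨k, hk⟩ : ∃ k, P' {ω | θ k ω ≤ σ ω} ≤ ε / 2 := by
    have hE : MemFtau F σ (⋃ k, {ω | σ ω < θ k ω})ᶜ :=
      (MemFtau.iUnion fun k => hσ.memFtau_lt_left hmono (hθ k)).compl hσ
    have hPE : P (⋃ k, {ω | σ ω < θ k ω})ᶜ = 0 := by
      refine mem_ae_iff.1 (hev.mono fun ω hω => ?_)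
      obtain ⟨k, hk⟩ := hω.exists
      refine mem_iUnion.2 ⟨k, ?_⟩
      simp only [mem_ofPred_eq, hk]
      linarith [hσT ω]
    have hae : ∀ᵐ ω ∂P', ω ∈ ⋃ k, {ω | σ ω < θ k ω} :=
      mem_ae_iff.2 (hnull σ hσ hσT hσS _ hE hPE)
    have := tendsto_measure_zero_of_ae_eventually_notMem hP' (fun k => hmeasle (hθ k))
      (hae.mono fun ω hω => ?_)
    · exact (this.eventually (ge_mem_nhds hε2)).exists
    · obtain ⟨k, hk⟩ := mem_iUnion.1 hω
      filter_upwards [eventually_ge_atTop k] with j hj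
      exact not_le.2 (lt_of_lt_of_le hk (monotone_nat_of_le_succ (fun i => hθmono i ω) hj))
  refine ⟨fun ω => min (H n ω) (θ k ω), (hH n).min (hθ k), ?_, ?_⟩
  · have hτ : IsStopT F T (fun ω => min (min (σ ω) (H n ω)) (θ k ω)) := (hHσ n).min (hθ k)
    have hopt : OptSampling F T P Z (fun ω => min (min (σ ω) (H n ω)) (θ k ω)) := by
      refine .of_isLocMart hP hmono hT hτ (fun ω => (min_le_left _ _).trans (hHσT n ω))
        (fun ρ hρ hle => hloc n ρ hρ fun ω => (hle ω).trans (min_le_left _ _)) ?_ h0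
      have := (hmart k).lintegral_eq hT
      simpa only [hstart (hHσ n) (hθ k), hend (hHσT n)] using this
    intro κ hκ hle
    have hle' : ∀ ω, κ ω ≤ min (min (σ ω) (H n ω)) (θ k ω) := fun ω => by
      rw [min_assoc]
      exact hle ω
    have hκσ : ∀ ω, κ ω ≤ σ ω := fun ω => (hle ω).trans (min_le_left _ _)
    rw [hval κ hκ (fun ω => (hκσ ω).trans (hσT ω))
      (hσS.mono fun ω hω => (hκσ ω).trans_lt hω)
      ((hHS n).mono fun ω hω => ((hle' ω).trans (min_le_left _ _)).trans_lt hω),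
      hopt κ hκ hle', hval0]
  · calc P' {ω | min (H n ω) (θ k ω) ≤ σ ω}
        ≤ P' ({ω | H n ω ≤ σ ω} ∪ {ω | θ k ω ≤ σ ω}) :=
          measure_mono fun ω (hω : min (H n ω) (θ k ω) ≤ σ ω) =>
            (min_le_iff.1 hω : H n ω ≤ σ ω ∨ θ k ω ≤ σ ω)
      _ ≤ ε / 2 + ε / 2 := (measure_union_le _ _).trans (add_le_add hn hk)
      _ = ε := ENNReal.add_halves ε

end Transfer

section ChangeOfMeasure

variable {Ω : Type*} {F : ℝ → MeasurableSpace Ω} {T : ℝ} {X : ℝ → Ω → ℝ≥0∞} {x₀ : ℝ≥0∞}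
  {Q Qh : @Measure Ω (F T)}

theorem NumeraireRel.apply (hnum : NumeraireRel F T X x₀ Q Qh) {κ : Ω → ℝ}
    (hκ : IsStopT F T κ) (hκT : ∀ ω, κ ω ≤ T) {A : Set Ω} (hA : MemFtau F κ A) :
    Qh (A ∩ {ω | X (κ ω) ω < ⊤}) = (∫⁻ ω in A, X (κ ω) ω ∂Q) / x₀ := by
  simpa only [valueAt, min_eq_left (hκT _)] using hnum κ hκ A hA

theorem NumeraireRel.setLIntegral (hnum : NumeraireRel F T X x₀ Q Qh) {κ : Ω → ℝ}
    (hκ : IsStopT F T κ) (hκT : ∀ ω, κ ω ≤ T)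
    (hX : Measurable[stopSigma hκ] fun ω => X (κ ω) ω) {f : Ω → ℝ≥0∞}
    (hf : Measurable[stopSigma hκ] f) :
    ∫⁻ ω in {ω | X (κ ω) ω < ⊤}, f ω ∂Qh = x₀⁻¹ * ∫⁻ ω, X (κ ω) ω * f ω ∂Q := by
  have hle := stopSigma_le hκ hκT
  have hXT : Measurable[F T] fun ω => X (κ ω) ω := hX.mono hle le_rfl
  have hfT : Measurable[F T] f := hf.mono hle le_rfl
  have hμ : (Qh.restrict {ω | X (κ ω) ω < ⊤}).trim hle =
      (x₀⁻¹ • Q.withDensity fun ω => X (κ ω) ω).trim hle := by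
    refine @Measure.ext _ (stopSigma hκ) _ _ fun A hA => ?_
    rw [trim_measurableSet_eq hle hA, trim_measurableSet_eq hle hA,
      Measure.restrict_apply (hle _ hA), hnum.apply hκ hκT hA, Measure.smul_apply,
      withDensity_apply _ (hle _ hA), smul_eq_mul, ENNReal.div_eq_inv_mul]
  rw [← lintegral_trim hle hf, hμ, lintegral_trim hle hf, lintegral_smul_measure,
    lintegral_withDensity_eq_lintegral_mul _ hXT hfT, smul_eq_mul]
  rfl

theorem progMeas_div {N : ℝ → Ω → ℝ≥0∞} (hN : ProgMeas F T N) (hX : ProgMeas F T X) :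
    ProgMeas F T
      (fun t => {ω | 0 < X t ω ∧ X t ω < ⊤}.indicator (fun ω => N t ω / X t ω)) := by
  intro t ht
  let _ : MeasurableSpace Ω := F t
  have h1 := hN t ht
  have h2 := hX t ht
  exact (h1.div h2).indicator
    ((measurableSet_lt measurable_const h2).inter (measurableSet_lt h2 measurable_const))

/-- Expectations of `N / X` under `Q̂` and of `N` under `Q` are proportional. -/
theorem NumeraireRel.lintegral_div (hmono : ∀ s t : ℝ, s ≤ t → F s ≤ F t) (hT : 0 < T)
    (hnum : NumeraireRel F T X x₀ Q Qh) (hX : ProgMeas F T X) {N : ℝ → Ω → ℝ≥0∞}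
    (hN : ProgMeas F T N) {κ : Ω → ℝ} (hκ : IsStopT F T κ) (hκT : ∀ ω, κ ω ≤ T)
    (hpos : ∀ᵐ ω ∂Q, 0 < X (κ ω) ω) (hfin : ∀ᵐ ω ∂Q, X (κ ω) ω < ⊤) :
    ∫⁻ ω, {ω' | 0 < X (κ ω) ω' ∧ X (κ ω) ω' < ⊤}.indicator
      (fun ω' => N (κ ω) ω' / X (κ ω) ω') ω ∂Qh = x₀⁻¹ * ∫⁻ ω, N (κ ω) ω ∂Q := by
  have hXκ := hX.measurable_stopSigma hmono hT hκ hκT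
  have key := hnum.setLIntegral hκ hκT hXκ
    ((progMeas_div hN hX).measurable_stopSigma hmono hT hκ hκT)
  have hms : MeasurableSet[F T] {ω | X (κ ω) ω < ⊤} :=
    stopSigma_le hκ hκT _ (hXκ measurableSet_Iio)
  have hsupp : ∫⁻ ω in {ω | X (κ ω) ω < ⊤}ᶜ, {ω' | 0 < X (κ ω) ω' ∧ X (κ ω) ω' < ⊤}.indicator
      (fun ω' => N (κ ω) ω' / X (κ ω) ω') ω ∂Qh = 0 := by
    rw [setLIntegral_congr_fun (g := fun _ => 0) hms.compl fun ω hω => ?_, lintegral_zero]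
    have hω' : ¬ X (κ ω) ω < ⊤ := hω
    exact indicator_of_notMem (fun h => hω' h.2) _
  rw [← lintegral_add_compl _ hms, hsupp, add_zero, key]
  congr 1
  refine lintegral_congr_ae ?_
  filter_upwards [hpos, hfin] with ω h1 h2
  rw [indicator_of_mem (show ω ∈ {ω' | 0 < X (κ ω) ω' ∧ X (κ ω) ω' < ⊤} from ⟨h1, h2⟩),
    ENNReal.mul_div_cancel h1.ne' h2.ne]

end ChangeOfMeasure

/-- Equivalence of local martingales, part (ii).  For a nonnegative
progressively measurable `N`: `N` is a `Q`-local martingale on `[0,S)` iff `N/X`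
(defined to be `0` where `X ∈ {0,∞}`) is a `Q̂`-local martingale on `[0,R)`. -/
theorem statement7 {Ω : Type*} (F : ℝ → MeasurableSpace Ω) (T : ℝ)
    (X : ℝ → Ω → ℝ≥0∞) (x₀ : ℝ≥0∞) (Q Qh : @Measure Ω (F T))
    (hsetup : Setup F T X x₀ Q) (hQh : IsProbabilityMeasure Qh)
    (hnum : NumeraireRel F T X x₀ Q Qh)
    (N : ℝ → Ω → ℝ≥0∞) (hN : ProgMeas F T N) :
    IsLocMartBefore F T Q N (St T X) ↔
    IsLocMartBefore F T Qh
      (fun t => {ω | 0 < X t ω ∧ X t ω < ⊤}.indicator (fun ω => N t ω / X t ω))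
      (Rt T X) := by
  obtain ⟨hT, hmono, hrc, hQ, had, hc, habs, hx0, hx0', hR, hinit, -⟩ := hsetup
  have h0mem : (0:ℝ) ∈ Icc (0:ℝ) T := ⟨le_rfl, hT.le⟩
  have hTmem : T ∈ Icc (0:ℝ) T := ⟨hT.le, le_rfl⟩
  have hXprog : ProgMeas F T X := progMeas_of_continuousOn hmono hc had
  have habs0 : ∀ ω, ∀ t ∈ Icc (0:ℝ) T, X t ω = 0 → ∀ s ∈ Icc t T, X s ω = X t ω :=
    fun ω t ht h => habs ω t ht (Or.inl h)
  have hcinv : ∀ ω, ContinuousOn (fun t => (X t ω)⁻¹) (Icc 0 T) := fun ω =>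
    continuous_inv.comp_continuousOn (hc ω)
  have hadinv : ∀ t ∈ Icc (0:ℝ) T, Measurable[F t] (fun ω => (X t ω)⁻¹) := fun t ht =>
    measurable_inv.comp (had t ht)
  have habsinv : ∀ ω, ∀ t ∈ Icc (0:ℝ) T, (X t ω)⁻¹ = 0 →
      ∀ s ∈ Icc t T, (X s ω)⁻¹ = (X t ω)⁻¹ := fun ω t ht h s hs => by
    rw [habs ω t ht (Or.inr (ENNReal.inv_eq_zero.1 h)) s hs]
  have hS_iff : ∀ {ω s}, s ∈ Icc (0:ℝ) T → (s < St T X ω ↔ 0 < X s ω) := fun hs =>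
    lt_St_iff hT hc habs0 hs
  have hR_iff : ∀ {ω s}, s ∈ Icc (0:ℝ) T → (s < Rt T X ω ↔ X s ω < ⊤) := fun {ω s} hs => by
    rw [Rt_eq_St_inv, lt_St_iff (Y := fun t ω => (X t ω)⁻¹) hT hcinv habsinv hs,
      ENNReal.inv_pos, lt_top_iff_ne_top]
  have hQ0 : ∀ᵐ ω ∂Q, 0 < X 0 ω := by
    have hm : MeasurableSet[F T] {ω | X 0 ω = x₀} :=
      hmono 0 T hT.le _ (had 0 h0mem (measurableSet_singleton x₀))
    have hae : ∀ᵐ ω ∂Q, X 0 ω = x₀ := (mem_ae_iff_prob_eq_one hm).2 hinit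
    exact hae.mono fun ω hω => hω ▸ hx0
  have hQT : ∀ᵐ ω ∂Q, X T ω < ⊤ := by
    have hm : MeasurableSet[F T] {ω | X T ω < ⊤} := had T hTmem measurableSet_Iio
    refine (mem_ae_iff_prob_eq_one hm).2 (le_antisymm prob_le_one (hR ▸ measure_mono ?_))
    intro ω hω
    have hω' : Rt T X ω = T + 1 := hω
    exact (hR_iff hTmem).1 (by linarith)
  have hQfin : ∀ κ, IsStopT F T κ → (∀ ω, κ ω ≤ T) → ∀ᵐ ω ∂Q, X (κ ω) ω < ⊤ := by
    intro κ hκ hκT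
    refine hQT.mono fun ω hω => (hR_iff ⟨hκ.nonneg hT ω, hκT ω⟩).1 ?_
    exact (hκT ω).trans_lt ((hR_iff hTmem).2 hω)
  have hQhT : ∀ᵐ ω ∂Qh, 0 < X T ω := by
    have hm : MeasurableSet[F T] {ω | X T ω = 0} := had T hTmem (measurableSet_singleton 0)
    have hmem : MemFtau F (fun _ => T) {ω | X T ω = 0} := by
      intro t
      by_cases h : T ≤ t
      · simpa [h] using hmono T t h _ hm
      · simp [h]
    have := hnum.apply (IsStopT.const hTmem) (fun _ => le_rfl) hmem
    rw [setLIntegral_congr_fun (g := fun _ => 0) hm fun ω hω => hω, lintegral_zero,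
      ENNReal.zero_div] at this
    refine mem_ae_iff.2 (measure_mono_null ?_ this)
    intro ω hω
    have hω' : X T ω = 0 := by simpa using hω
    exact ⟨hω', by simp [hω']⟩
  have hQh0 : ∀ᵐ ω ∂Qh, X 0 ω < ⊤ := by
    have hm : MeasurableSet[F T] {ω | X 0 ω < ⊤} :=
      hmono 0 T hT.le _ (had 0 h0mem measurableSet_Iio)
    have hzero : IsStopT F T (fun _ : Ω => (0:ℝ)) := IsStopT.const h0mem
    have := hnum.apply hzero (fun _ => hT.le) (A := univ)
      fun t => by simp [hzero.1 t]
    have hm' : MeasurableSet[F T] {ω | X 0 ω = x₀} :=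
      hmono 0 T hT.le _ (had 0 h0mem (measurableSet_singleton x₀))
    have hae : ∀ᵐ ω ∂Q, X 0 ω = x₀ := (mem_ae_iff_prob_eq_one hm').2 hinit
    rw [univ_inter, Measure.restrict_univ, lintegral_congr_ae hae, lintegral_const,
      measure_univ, mul_one, ENNReal.div_self hx0.ne' hx0'.ne] at this
    exact (mem_ae_iff_prob_eq_one hm).2 this
  constructor
  · refine IsLocMartBefore.transfer hmono hT hrc hQ hQh (progMeas_div hN hXprog) hc had habs0
      hQ0 hQhT (ENNReal.inv_ne_top.2 hx0.ne') ?_ ?_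
    · intro κ hκ hκT _ hS
      exact hnum.lintegral_div hmono hT hXprog hN hκ hκT
        (hS.mono fun ω hω => (hS_iff ⟨hκ.nonneg hT ω, hκT ω⟩).1 hω) (hQfin κ hκ hκT)
    · intro κ hκ hκT hκR E hE hQE
      have := hnum.apply hκ hκT hE
      rw [setLIntegral_measure_zero _ _ hQE, ENNReal.zero_div] at this
      rw [← this]
      refine measure_congr (hκR.mono fun ω hω => ?_)
      have hω' := (hR_iff ⟨hκ.nonneg hT ω, hκT ω⟩).1 hω
      exact propext ⟨fun h => ⟨h, hω'⟩, fun h => h.1⟩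
  · rw [Rt_eq_St_inv]
    refine IsLocMartBefore.transfer hmono hT hrc hQh hQ hN hcinv hadinv habsinv
      (hQh0.mono fun ω hω => ENNReal.inv_pos.2 hω.ne)
      (hQT.mono fun ω hω => ENNReal.inv_pos.2 hω.ne) hx0'.ne ?_ ?_
    · intro κ hκ hκT hS _
      have := hnum.lintegral_div hmono hT hXprog hN hκ hκT
        (hS.mono fun ω hω => (hS_iff ⟨hκ.nonneg hT ω, hκT ω⟩).1 hω) (hQfin κ hκ hκT)
      rw [this, ← mul_assoc, ENNReal.mul_inv_cancel hx0.ne' hx0'.ne, one_mul]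
    · intro κ hκ hκT hκS E hE hQhE
      have hET := hE.measurableSet hκT
      have := hnum.apply hκ hκT hE
      rw [measure_mono_null inter_subset_left hQhE, eq_comm, ENNReal.div_eq_zero_iff,
        or_iff_left hx0'.ne] at this
      have hXm : Measurable[F T] fun ω => X (κ ω) ω :=
        (hXprog.measurable_stopSigma hmono hT hκ hκT).mono (stopSigma_le hκ hκT) le_rfl
      rw [lintegral_eq_zero_iff hXm, EventuallyEq, ae_restrict_iff' hET] at this
      refine measure_eq_zero_iff_ae_notMem.2 ?_
      filter_upwards [this, hκS] with ω h1 h2 h3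
      exact ((hS_iff ⟨hκ.nonneg hT ω, hκT ω⟩).1 h2).ne' (h1 h3)

end Paper
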